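/- Let h : ℝⁿ → ℝ be continuous and C ∈ ℝ. Then the following are equivalent: (i) h(x + z) − 2 h(x) + h(x − z) ≤ C ‖z‖² for all x, z ∈ ℝⁿ; (ii) the function x ↦ h(x) − (C/2) ‖x‖² is concave on ℝⁿ. -/

import Mathlib

/-- A continuous midpoint-concave function on a convex set is concave. -/
theorem ConcaveOn.of_midpoint_of_continuousOn {E : Type*} [AddCommGroup E] [Module ℝ E]
    [TopologicalSpace E] [ContinuousAdd E] [ContinuousSMul ℝ E] {s : Set E} {f : E → ℝ}
    (hs : Convex ℝ s) (hf : ContinuousOn f s)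
    (hmid : ∀ x ∈ s, ∀ y ∈ s, f x + f y ≤ 2 * f (midpoint ℝ x y)) : ConcaveOn ℝ s f := by
  refine ⟨hs, fun x hx y hy a b ha hb hab => ?_⟩
  let c : ℝ → E := fun t => (1 - t) • x + t • y
  have hcs : Set.MapsTo c (Set.Icc 0 1) s := fun t ht =>
    hs hx hy (sub_nonneg.2 ht.2) ht.1 (sub_add_cancel _ _)
  let g : ℝ → ℝ := fun t => f (c t) - ((1 - t) * f x + t * f y)
  have hcc : Continuous c := by fun_prop
  have hg : ContinuousOn g (Set.Icc 0 1) :=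
    (hf.comp hcc.continuousOn hcs).sub (by fun_prop)
  have hg0 : g 0 = 0 := by simp [g, c]
  have hg1 : g 1 = 0 := by simp [g, c]
  have hgmid : ∀ t d : ℝ, t - d ∈ Set.Icc (0 : ℝ) 1 → t + d ∈ Set.Icc (0 : ℝ) 1 →
      g (t - d) + g (t + d) ≤ 2 * g t := by
    intro t d h₁ h₂
    have h := hmid _ (hcs h₁) _ (hcs h₂)
    have hc : midpoint ℝ (c (t - d)) (c (t + d)) = c t := by
      simp only [midpoint_eq_smul_add, c, invOf_eq_inv]
      module
    rw [hc] at h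
    simp only [g]
    linarith
  obtain ⟨t, ht, hmin⟩ := isCompact_Icc.exists_isMinOn ⟨0, by simp⟩ hg
  have htnonneg : 0 ≤ g t := by
    obtain ⟨ht₀, ht₁⟩ := ht
    rcases le_total t (1 / 2) with h | h
    · have hmem : t + t ∈ Set.Icc (0 : ℝ) 1 := ⟨by linarith, by linarith⟩
      have h₁ := hgmid t t (by simp) hmem
      have h₂ : g t ≤ g (t + t) := hmin hmem
      rw [sub_self, hg0] at h₁
      linarith
    · have hmem : t - (1 - t) ∈ Set.Icc (0 : ℝ) 1 := ⟨by linarith, by linarith⟩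
      have h₁ := hgmid t (1 - t) hmem (by simp)
      have h₂ : g t ≤ g (t - (1 - t)) := hmin hmem
      rw [add_sub_cancel, hg1] at h₁
      linarith
  have hgb : g t ≤ g b := hmin ⟨hb, by linarith⟩
  obtain rfl : a = 1 - b := by linarith
  simpa only [g, c, smul_eq_mul, sub_nonneg] using htnonneg.trans hgb

/-- For a continuous `h : ℝⁿ → ℝ`, the second-difference bound
`h(x+z) − 2h(x) + h(x−z) ≤ C‖z‖²` holds for all `x, z` iff
`x ↦ h(x) − (C/2)‖x‖²` is concave on `ℝⁿ`. -/
theorem second_difference_iff_concave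
    {n : ℕ} (h : EuclideanSpace ℝ (Fin n) → ℝ) (hc : Continuous h) (C : ℝ) :
    (∀ x z : EuclideanSpace ℝ (Fin n), h (x + z) - 2 * h x + h (x - z) ≤ C * ‖z‖ ^ 2) ↔
      ConcaveOn ℝ Set.univ (fun x => h x - (C / 2) * ‖x‖ ^ 2) := by
  have hpar (x z : EuclideanSpace ℝ (Fin n)) :
      C * ‖x + z‖ ^ 2 + C * ‖x - z‖ ^ 2 = 2 * (C * ‖x‖ ^ 2) + 2 * (C * ‖z‖ ^ 2) := by
    linear_combination C * parallelogram_law_with_norm ℝ x z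
  constructor
  · intro H
    refine ConcaveOn.of_midpoint_of_continuousOn convex_univ (by fun_prop) fun x _ y _ => ?_
    let m := midpoint ℝ x y
    let z := (2⁻¹ : ℝ) • (x - y)
    have hx : m + z = x := by
      simp only [m, z, midpoint_eq_smul_add, invOf_eq_inv]
      module
    have hy : m - z = y := by
      simp only [m, z, midpoint_eq_smul_add, invOf_eq_inv]
      module
    have h₁ := H m z
    have h₂ := hpar m z
    rw [hx, hy] at h₁ h₂
    change _ ≤ 2 * (h m - C / 2 * ‖m‖ ^ 2)
    linarith
  · intro H x z
    have h₁ := H.2 (Set.mem_univ (x + z)) (Set.mem_univ (x - z))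
      (by norm_num : (0 : ℝ) ≤ 2⁻¹) (by norm_num : (0 : ℝ) ≤ 2⁻¹) (by norm_num)
    have hx : (2⁻¹ : ℝ) • (x + z) + (2⁻¹ : ℝ) • (x - z) = x := by module
    simp only [hx, smul_eq_mul] at h₁
    linarith [hpar x z]
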